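/- Let a > b > 0, k > 0, q > 0 with q ≠ 1, let D = {(x₁,x₂) ∈ ℝ² : x₁²/a² + x₂²/b² < 1}, let n ∈ ℤ, and let h_n : ℝ² → ℂ be the Herglotz wave h_n(x) = ∫_{−π}^{π} e^{inα}·exp( i·k·(x₁·cos α + x₂·sin α) ) dα. Suppose at least one of the following holds: (i) J_n(k·√(a²+b²)) ≠ 0; (ii) n ≤ 5; (iii) n > 5 and a²/b² ≠ (n − 2 + √((n−5)(n+1)))/3. Then the function λ ↦ ∫_D h_n(x)·exp(λ·x₁ + i·√(λ²+k²q)·x₂) dx is not identically zero on (0,∞). (Consequently, h_n is scattered by the elliptical region D with constant refractive index q.) -/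

import Mathlib

open Complex MeasureTheory

noncomputable section

/-- Bessel function of the first kind of nonnegative integer order, as an entire function. -/
def besselJNat (ν : ℕ) (z : ℂ) : ℂ :=
  ∑' m : ℕ, ((-1 : ℂ) ^ m / ((Nat.factorial m : ℂ) * (Nat.factorial (m + ν) : ℂ)))
    * (z / 2) ^ (2 * m + ν)

/-- Bessel function of the first kind of integer order: `J_{−n} = (−1)^n J_n`. -/
def besselJ (n : ℤ) (z : ℂ) : ℂ :=
  if 0 ≤ n then besselJNat n.toNat z else (-1 : ℂ) ^ n * besselJNat (-n).toNat z

/-- The Herglotz wave `h_n(x) = ∫_{−π}^{π} e^{inα} e^{ik x·(cos α, sin α)} dα`. -/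
def herglotzH (n : ℤ) (k : ℝ) (x : ℝ × ℝ) : ℂ :=
  ∫ α in (-Real.pi)..Real.pi,
    Complex.exp (Complex.I * (n : ℂ) * (α : ℂ)) *
      Complex.exp (Complex.I * (k : ℂ) * ((x.1 : ℂ) * ((Real.cos α : ℝ) : ℂ)
        + (x.2 : ℂ) * ((Real.sin α : ℝ) : ℂ)))

/-- The point `e^{iα}` of the unit circle. -/
def circlePt (α : ℝ) : ℂ := Complex.exp (Complex.I * (α : ℂ))

lemma circlePt_ne_zero (α : ℝ) : circlePt α ≠ 0 := Complex.exp_ne_zero _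

lemma norm_circlePt (α : ℝ) : ‖circlePt α‖ = 1 := by
  simp [circlePt, Complex.norm_exp]

@[fun_prop]
lemma continuous_circlePt : Continuous circlePt := by
  unfold circlePt; fun_prop

@[fun_prop]
lemma continuous_circlePt_zpow (n : ℤ) : Continuous fun α => circlePt α ^ n :=
  continuous_circlePt.zpow₀ n fun α => Or.inl (circlePt_ne_zero α)

@[fun_prop]
lemma continuous_circlePt_inv : Continuous fun α => (circlePt α)⁻¹ :=
  continuous_circlePt.inv₀ circlePt_ne_zero

lemma circlePt_neg (α : ℝ) : circlePt (-α) = (circlePt α)⁻¹ := by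
  simp [circlePt, Complex.exp_neg]

lemma circlePt_add_pi (α : ℝ) : circlePt (α + Real.pi) = -circlePt α := by
  simp [circlePt, mul_add, Complex.exp_add, mul_comm Complex.I (Real.pi : ℂ)]

lemma circlePt_zpow (α : ℝ) (n : ℤ) :
    circlePt α ^ n = Complex.exp (Complex.I * (n : ℂ) * (α : ℂ)) := by
  rw [circlePt, ← Complex.exp_int_mul]
  congr 1; ring

lemma circlePt_eq (α : ℝ) : circlePt α = (Real.cos α : ℂ) + Complex.I * (Real.sin α : ℂ) := by
  rw [circlePt, mul_comm, Complex.exp_mul_I]; push_cast; ring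

lemma circlePt_inv_eq (α : ℝ) :
    (circlePt α)⁻¹ = (Real.cos α : ℂ) - Complex.I * (Real.sin α : ℂ) := by
  rw [← circlePt_neg, circlePt_eq]; push_cast; simp; ring

lemma hasDerivAt_circlePt (α : ℝ) :
    HasDerivAt circlePt (Complex.I * circlePt α) α := by
  have h : HasDerivAt (fun α : ℝ => Complex.I * (α : ℂ)) (Complex.I * 1) α :=
    (Complex.ofRealCLM.hasDerivAt (x := α)).const_mul Complex.I
  have := h.cexp
  rw [mul_one, mul_comm] at this
  exact this

lemma integral_circlePt_zpow (n : ℤ) :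
    ∫ α in (-Real.pi)..Real.pi, circlePt α ^ n = if n = 0 then 2 * (Real.pi : ℂ) else 0 := by
  split_ifs with h
  · subst h
    simp only [zpow_zero, intervalIntegral.integral_const, sub_neg_eq_add]
    rw [Complex.real_smul]; push_cast; ring
  · simp_rw [circlePt_zpow]
    have hc : Complex.I * (n : ℂ) ≠ 0 := mul_ne_zero Complex.I_ne_zero (by exact_mod_cast h)
    rw [integral_exp_mul_complex hc]
    have : Complex.exp (Complex.I * (n : ℂ) * (Real.pi : ℂ)) =
        Complex.exp (Complex.I * (n : ℂ) * ((-Real.pi : ℝ) : ℂ)) := by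
      rw [Complex.exp_eq_exp_iff_exists_int]
      exact ⟨n, by push_cast; ring⟩
    rw [this, sub_self, zero_div]

/-- Termwise integration of the exponential series against a continuous weight. -/
lemma hasSum_integral_pow_div_factorial {f φ : ℝ → ℂ} (hf : Continuous f) (hφ : Continuous φ)
    (a b : ℝ) :
    HasSum (fun j : ℕ => ∫ α in a..b, f α * (φ α ^ j / (j.factorial : ℂ)))
      (∫ α in a..b, f α * Complex.exp (φ α)) := by
  have hs : ∀ y : ℝ, HasSum (fun j : ℕ => y ^ j / (j.factorial : ℝ)) (Real.exp y) := by
    intro y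
    rw [Real.exp_eq_exp_ℝ]
    exact NormedSpace.expSeries_div_hasSum_exp y
  refine intervalIntegral.hasSum_integral_of_dominated_convergence
    (fun (j : ℕ) α => ‖f α‖ * (‖φ α‖ ^ j / (j.factorial : ℝ))) (fun j => ?_) (fun j => ?_) ?_ ?_ ?_
  · exact Continuous.aestronglyMeasurable (by fun_prop)
  · filter_upwards with α _
    simp
  · filter_upwards with α _
    exact ((hs _).mul_left _).summable
  · have : (fun α => ∑' j : ℕ, ‖f α‖ * (‖φ α‖ ^ j / (j.factorial : ℝ))) =
        fun α => ‖f α‖ * Real.exp ‖φ α‖ := by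
      funext α
      exact ((hs _).mul_left _).tsum_eq
    rw [this]
    exact Continuous.intervalIntegrable (by fun_prop) _ _
  · filter_upwards with α _
    rw [Complex.exp_eq_exp_ℂ]
    exact (NormedSpace.expSeries_div_hasSum_exp (φ α)).mul_left _

/-- The moments `∫ zⁿ exp(p z + r / z) dα` with `z = e^{iα}`. -/
def expMoment (n : ℤ) (p r : ℂ) : ℂ :=
  ∫ α in (-Real.pi)..Real.pi, circlePt α ^ n * Complex.exp (p * circlePt α + r * (circlePt α)⁻¹)

/-- The Bessel–Clifford function `∑ tᵐ / (m! (m+j)!)`. -/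
def besselClifford (j : ℕ) (t : ℂ) : ℂ :=
  ∑' m : ℕ, t ^ m / ((m.factorial : ℂ) * ((m + j).factorial : ℂ))

lemma expMoment_zero_left (n : ℕ) (r : ℂ) :
    expMoment n 0 r = 2 * (Real.pi : ℂ) * (r ^ n / (n.factorial : ℂ)) := by
  have h := hasSum_integral_pow_div_factorial (f := fun α => circlePt α ^ (n : ℤ))
    (φ := fun α => r * (circlePt α)⁻¹) (by fun_prop) (by fun_prop) (-Real.pi) Real.pi
  have hterm : ∀ j : ℕ, (∫ α in (-Real.pi)..Real.pi,
      circlePt α ^ (n : ℤ) * ((r * (circlePt α)⁻¹) ^ j / (j.factorial : ℂ))) =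
      if j = n then 2 * (Real.pi : ℂ) * (r ^ n / (n.factorial : ℂ)) else 0 := by
    intro j
    have : ∀ α : ℝ, circlePt α ^ (n : ℤ) * ((r * (circlePt α)⁻¹) ^ j / (j.factorial : ℂ)) =
        (r ^ j / (j.factorial : ℂ)) * circlePt α ^ ((n : ℤ) - j) := by
      intro α
      rw [zpow_sub₀ (circlePt_ne_zero α), mul_pow, inv_pow, zpow_natCast, zpow_natCast]
      ring
    simp_rw [this]
    rw [intervalIntegral.integral_const_mul, integral_circlePt_zpow]
    by_cases hj : j = n
    · subst hj; simp; ring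
    · rw [if_neg (by omega), if_neg hj, mul_zero]
  simp_rw [hterm] at h
  have h2 := h.unique (hasSum_ite_eq n _)
  simpa [expMoment] using h2

lemma hasSum_expMoment (n : ℕ) (p r : ℂ) :
    HasSum (fun m : ℕ => 2 * (Real.pi : ℂ) * r ^ n *
      ((p * r) ^ m / ((m.factorial : ℂ) * ((m + n).factorial : ℂ)))) (expMoment n p r) := by
  have h := hasSum_integral_pow_div_factorial
    (f := fun α => circlePt α ^ (n : ℤ) * Complex.exp (r * (circlePt α)⁻¹))
    (φ := fun α => p * circlePt α) (by fun_prop) (by fun_prop) (-Real.pi) Real.pi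
  have hsum : (∫ α in (-Real.pi)..Real.pi, circlePt α ^ (n : ℤ) *
      Complex.exp (r * (circlePt α)⁻¹) * Complex.exp (p * circlePt α)) = expMoment n p r := by
    unfold expMoment
    congr 1; funext α
    rw [add_comm, Complex.exp_add, mul_assoc]
  rw [hsum] at h
  convert h using 2 with m
  have : ∀ α : ℝ, circlePt α ^ (n : ℤ) * Complex.exp (r * (circlePt α)⁻¹) *
      ((p * circlePt α) ^ m / (m.factorial : ℂ)) = (p ^ m / (m.factorial : ℂ)) *
      (circlePt α ^ (((m + n : ℕ) : ℤ)) *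
        Complex.exp (0 * circlePt α + r * (circlePt α)⁻¹)) := by
    intro α
    simp only [zpow_natCast, pow_add, mul_pow, zero_mul, zero_add]
    ring
  simp_rw [this]
  rw [intervalIntegral.integral_const_mul]
  change _ = _ * expMoment ((m + n : ℕ) : ℤ) 0 r
  rw [expMoment_zero_left]
  have h1 : (m.factorial : ℂ) ≠ 0 := by exact_mod_cast m.factorial_ne_zero
  have h2 : ((m + n).factorial : ℂ) ≠ 0 := by exact_mod_cast (m + n).factorial_ne_zero
  field_simp
  ring

lemma hasSum_besselClifford (j : ℕ) (t : ℂ) :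
    HasSum (fun m : ℕ => t ^ m / ((m.factorial : ℂ) * ((m + j).factorial : ℂ)))
      (besselClifford j t) := by
  have h := hasSum_expMoment j t 1
  have hpi : (2 * (Real.pi : ℂ)) ≠ 0 := by simp [Real.pi_ne_zero]
  simp only [one_pow, mul_one] at h
  exact ((summable_mul_left_iff hpi).1 h.summable).hasSum

lemma expMoment_natCast (n : ℕ) (p r : ℂ) :
    expMoment n p r = 2 * (Real.pi : ℂ) * r ^ n * besselClifford n (p * r) :=
  (hasSum_expMoment n p r).unique ((hasSum_besselClifford n (p * r)).mul_left _)

lemma expMoment_one_right (n : ℕ) (t : ℂ) :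
    expMoment n t 1 = 2 * (Real.pi : ℂ) * besselClifford n t := by
  simp [expMoment_natCast]

lemma expMoment_neg (n : ℤ) (p r : ℂ) : expMoment (-n) p r = expMoment n r p := by
  have h := intervalIntegral.integral_comp_neg (a := -Real.pi) (b := Real.pi)
    (fun α => circlePt α ^ n * Complex.exp (r * circlePt α + p * (circlePt α)⁻¹))
  rw [neg_neg] at h
  rw [expMoment, expMoment, ← h]
  congr 1; funext α
  rw [circlePt_neg, inv_inv, inv_zpow', add_comm]

lemma integral_circle_eq_zero_of_hasDerivAt {f f' : ℝ → ℂ} (hf : ∀ α, HasDerivAt f (f' α) α)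
    (hf' : Continuous f') (hper : f Real.pi = f (-Real.pi)) :
    ∫ α in (-Real.pi)..Real.pi, f' α = 0 := by
  rw [intervalIntegral.integral_eq_sub_of_hasDerivAt (fun x _ => hf x)
    (hf'.intervalIntegrable _ _), hper, sub_self]

lemma expMoment_recurrence (n : ℤ) (p r : ℂ) :
    (n : ℂ) * expMoment n p r + p * expMoment (n + 1) p r - r * expMoment (n - 1) p r = 0 := by
  have hper : circlePt Real.pi = circlePt (-Real.pi) := by
    rw [circlePt_eq, circlePt_eq]; simp
  have hI := integral_circle_eq_zero_of_hasDerivAt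
    (f := fun α => circlePt α ^ n * Complex.exp (p * circlePt α + r * (circlePt α)⁻¹))
    (f' := fun α => Complex.I * ((n : ℂ) * (circlePt α ^ n *
        Complex.exp (p * circlePt α + r * (circlePt α)⁻¹)) + p * (circlePt α ^ (n + 1) *
        Complex.exp (p * circlePt α + r * (circlePt α)⁻¹)) - r * (circlePt α ^ (n - 1) *
        Complex.exp (p * circlePt α + r * (circlePt α)⁻¹)))) ?_ (by fun_prop) (by simp only [hper])
  · rw [intervalIntegral.integral_const_mul, intervalIntegral.integral_sub,
      intervalIntegral.integral_add, intervalIntegral.integral_const_mul,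
      intervalIntegral.integral_const_mul, intervalIntegral.integral_const_mul] at hI
    · exact (mul_eq_zero.1 hI).resolve_left Complex.I_ne_zero
    all_goals exact Continuous.intervalIntegrable (by fun_prop) _ _
  · intro α
    have h0 := circlePt_ne_zero α
    have hz := hasDerivAt_circlePt α
    have h1 : HasDerivAt (fun α => circlePt α ^ n)
        ((n : ℂ) * circlePt α ^ (n - 1) * (Complex.I * circlePt α)) α :=
      (hasDerivAt_zpow n (circlePt α) (Or.inl h0)).comp α hz
    have h2 := ((hz.const_mul p).add ((hz.fun_inv h0).const_mul r)).cexp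
    refine (h1.mul h2).congr_deriv ?_
    simp only [Pi.add_apply]
    rw [zpow_add_one₀ h0, zpow_sub_one₀ h0]
    field_simp
    ring

lemma besselClifford_recurrence (j : ℕ) (t : ℂ) :
    besselClifford j t - (j + 1) * besselClifford (j + 1) t = t * besselClifford (j + 2) t := by
  have h := expMoment_recurrence ((j + 1 : ℕ) : ℤ) t 1
  have e1 : (((j + 1 : ℕ) : ℤ) + 1) = ((j + 2 : ℕ) : ℤ) := by push_cast; ring
  have e2 : (((j + 1 : ℕ) : ℤ) - 1) = ((j : ℕ) : ℤ) := by push_cast; ring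
  rw [e1, e2, expMoment_one_right, expMoment_one_right, expMoment_one_right] at h
  have hpi : (2 * (Real.pi : ℂ)) ≠ 0 := by simp [Real.pi_ne_zero]
  apply mul_left_cancel₀ hpi
  push_cast at h
  linear_combination -h

lemma hasSum_besselClifford_add (j : ℕ) (s d : ℂ) :
    HasSum (fun m : ℕ => d ^ m / (m.factorial : ℂ) * besselClifford (j + m) s)
      (besselClifford j (s + d)) := by
  have h := hasSum_integral_pow_div_factorial
    (f := fun α => circlePt α ^ (j : ℤ) * Complex.exp (s * circlePt α + 1 * (circlePt α)⁻¹))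
    (φ := fun α => d * circlePt α) (by fun_prop) (by fun_prop) (-Real.pi) Real.pi
  have hsum : (∫ α in (-Real.pi)..Real.pi, circlePt α ^ (j : ℤ) *
      Complex.exp (s * circlePt α + 1 * (circlePt α)⁻¹) * Complex.exp (d * circlePt α)) =
      expMoment j (s + d) 1 := by
    unfold expMoment
    congr 1; funext α
    rw [mul_assoc, ← Complex.exp_add]
    congr 2; ring
  rw [hsum, expMoment_one_right] at h
  have hpi : (2 * (Real.pi : ℂ)) ≠ 0 := by simp [Real.pi_ne_zero]
  rw [← hasSum_mul_left_iff hpi]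
  suffices hterm : ∀ m : ℕ, (∫ α in (-Real.pi)..Real.pi, circlePt α ^ (j : ℤ) *
      Complex.exp (s * circlePt α + 1 * (circlePt α)⁻¹) *
      ((d * circlePt α) ^ m / (m.factorial : ℂ))) =
      2 * (Real.pi : ℂ) * (d ^ m / (m.factorial : ℂ) * besselClifford (j + m) s) by
    simpa only [hterm] using h
  intro m
  have : ∀ α : ℝ, circlePt α ^ (j : ℤ) * Complex.exp (s * circlePt α + 1 * (circlePt α)⁻¹) *
      ((d * circlePt α) ^ m / (m.factorial : ℂ)) = (d ^ m / (m.factorial : ℂ)) *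
      (circlePt α ^ (((j + m : ℕ) : ℤ)) *
        Complex.exp (s * circlePt α + 1 * (circlePt α)⁻¹)) := by
    intro α
    simp only [zpow_natCast, pow_add, mul_pow]
    ring
  simp_rw [this]
  rw [intervalIntegral.integral_const_mul]
  change _ * expMoment ((j + m : ℕ) : ℤ) s 1 = _
  rw [expMoment_one_right]
  ring

@[fun_prop]
lemma continuous_besselClifford (j : ℕ) : Continuous (besselClifford j) := by
  have hpi : (2 * (Real.pi : ℂ)) ≠ 0 := by simp [Real.pi_ne_zero]
  have h : besselClifford j = fun t => (2 * (Real.pi : ℂ))⁻¹ * expMoment j t 1 := by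
    funext t
    rw [expMoment_one_right]; field_simp
  rw [h]
  refine continuous_const.mul ?_
  unfold expMoment
  refine intervalIntegral.continuous_parametric_intervalIntegral_of_continuous' ?_ _ _
  have h1 : Continuous fun x : ℂ × ℝ => circlePt x.2 ^ (j : ℤ) :=
    (continuous_circlePt_zpow j).comp continuous_snd
  have h2 : Continuous fun x : ℂ × ℝ => (circlePt x.2)⁻¹ :=
    continuous_circlePt_inv.comp continuous_snd
  unfold Function.uncurry
  fun_prop

/-- Two consecutive moments cannot vanish simultaneously. -/
lemma expMoment_succ_ne_zero {n : ℤ} {p r : ℂ} (hp : p ≠ 0) (hr : r ≠ 0)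
    (h0 : expMoment n p r = 0) : expMoment (n + 1) p r ≠ 0 := by
  intro h1
  have hall : ∀ m : ℤ, expMoment m p r = 0 := by
    have key : ∀ m : ℤ, expMoment m p r = 0 ∧ expMoment (m + 1) p r = 0 := by
      intro m
      induction m using Int.inductionOn' (b := n) with
      | zero => exact ⟨h0, h1⟩
      | succ k _ ih =>
        refine ⟨ih.2, ?_⟩
        have h := expMoment_recurrence (k + 1) p r
        rw [add_sub_cancel_right, ih.1, ih.2] at h
        simpa [hp] using h
      | pred k _ ih =>
        rw [sub_add_cancel]
        refine ⟨?_, ih.1⟩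
        have h := expMoment_recurrence k p r
        rw [ih.1, ih.2] at h
        simpa [hr] using h
    exact fun m => (key m).1
  have hpow : ∀ (j : ℕ) (m : ℤ), ∫ α in (-Real.pi)..Real.pi, circlePt α ^ m *
      (Complex.exp (p * circlePt α + r * (circlePt α)⁻¹) *
        (-(p * circlePt α + r * (circlePt α)⁻¹)) ^ j) = 0 := by
    intro j
    induction j with
    | zero => intro m; simpa [expMoment] using hall m
    | succ j ih =>
      intro m
      have : ∀ α, circlePt α ^ m * (Complex.exp (p * circlePt α + r * (circlePt α)⁻¹) *
          (-(p * circlePt α + r * (circlePt α)⁻¹)) ^ (j + 1)) =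
          -p * (circlePt α ^ (m + 1) * (Complex.exp (p * circlePt α + r * (circlePt α)⁻¹) *
            (-(p * circlePt α + r * (circlePt α)⁻¹)) ^ j)) +
          -r * (circlePt α ^ (m - 1) * (Complex.exp (p * circlePt α + r * (circlePt α)⁻¹) *
            (-(p * circlePt α + r * (circlePt α)⁻¹)) ^ j)) := by
        intro α
        rw [zpow_add_one₀ (circlePt_ne_zero α), zpow_sub_one₀ (circlePt_ne_zero α)]
        ring
      simp_rw [this]
      rw [intervalIntegral.integral_add, intervalIntegral.integral_const_mul,
        intervalIntegral.integral_const_mul, ih, ih]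
      · simp
      all_goals exact Continuous.intervalIntegrable (by fun_prop) _ _
  have h := hasSum_integral_pow_div_factorial
    (f := fun α => Complex.exp (p * circlePt α + r * (circlePt α)⁻¹))
    (φ := fun α => -(p * circlePt α + r * (circlePt α)⁻¹)) (by fun_prop) (by fun_prop)
    (-Real.pi) Real.pi
  have hz : ∀ j : ℕ, ∫ α in (-Real.pi)..Real.pi,
      Complex.exp (p * circlePt α + r * (circlePt α)⁻¹) *
      ((-(p * circlePt α + r * (circlePt α)⁻¹)) ^ j / (j.factorial : ℂ)) = 0 := by
    intro j
    have := hpow j 0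
    simp only [zpow_zero, one_mul] at this
    simp_rw [← mul_div_assoc]
    rw [intervalIntegral.integral_div, this, zero_div]
  simp_rw [hz, ← Complex.exp_add, add_neg_cancel, Complex.exp_zero] at h
  have h2 := h.unique hasSum_zero
  simp [Real.pi_ne_zero] at h2

lemma expMoment_neg_neg (n : ℤ) (p r : ℂ) :
    expMoment n (-p) (-r) = (-1) ^ n * expMoment n p r := by
  have hper : Function.Periodic (fun α => circlePt α ^ n *
      Complex.exp (p * circlePt α + r * (circlePt α)⁻¹)) (2 * Real.pi) := by
    intro α
    have : circlePt (α + 2 * Real.pi) = circlePt α := by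
      rw [two_mul, ← add_assoc, circlePt_add_pi, circlePt_add_pi, neg_neg]
    simp only [this]
  have h := hper.intervalIntegral_add_eq (-Real.pi) 0
  have hs := intervalIntegral.integral_comp_add_right (a := -Real.pi) (b := Real.pi)
    (fun α => circlePt α ^ n * Complex.exp (p * circlePt α + r * (circlePt α)⁻¹)) Real.pi
  have e1 : -Real.pi + 2 * Real.pi = Real.pi := by ring
  have e2 : Real.pi + Real.pi = 0 + 2 * Real.pi := by ring
  rw [e1] at h
  rw [neg_add_cancel, e2, ← h] at hs
  rw [expMoment, expMoment, ← hs, ← intervalIntegral.integral_const_mul]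
  congr 1; funext α
  rw [circlePt_add_pi, neg_eq_neg_one_mul (circlePt α), mul_zpow, ← mul_assoc, ← mul_assoc,
    ← mul_zpow]
  simp only [neg_mul, one_mul, neg_neg, mul_neg, inv_neg, one_zpow]

/-- The Bessel–Clifford function on the real line. -/
def besselCliffordReal (j : ℕ) (t : ℝ) : ℝ :=
  ∑' m : ℕ, t ^ m / ((m.factorial : ℝ) * ((m + j).factorial : ℝ))

lemma besselClifford_ofReal (j : ℕ) (t : ℝ) :
    besselClifford j (t : ℂ) = ((besselCliffordReal j t : ℝ) : ℂ) := by
  rw [besselClifford, besselCliffordReal, Complex.ofReal_tsum]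
  push_cast
  rfl

lemma hasSum_besselCliffordReal (j : ℕ) (t : ℝ) :
    HasSum (fun m : ℕ => t ^ m / ((m.factorial : ℝ) * ((m + j).factorial : ℝ)))
      (besselCliffordReal j t) := by
  have h := hasSum_besselClifford j (t : ℂ)
  rw [besselClifford_ofReal] at h
  rw [← Complex.hasSum_ofReal]
  push_cast
  exact h

lemma besselCliffordReal_pos (j : ℕ) {t : ℝ} (ht : 0 ≤ t) : 0 < besselCliffordReal j t := by
  have h := hasSum_besselCliffordReal j t
  refine lt_of_lt_of_le ?_ (le_hasSum h 0 fun m _ => by positivity)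
  positivity

lemma mul_besselCliffordReal_succ_le (j : ℕ) (x : ℝ) :
    x * besselCliffordReal (j + 1) (x ^ 2) ≤ besselCliffordReal j (x ^ 2) := by
  have h1 := (hasSum_besselCliffordReal (j + 1) (x ^ 2)).mul_left x
  have h2 := hasSum_besselCliffordReal j (x ^ 2)
  have h3 := (hasSum_nat_add_iff' 1).2 h2
  have h4 := (h2.mul_left (1 / 2)).add (h3.mul_left (1 / 2))
  have hle := hasSum_le (fun m => ?_) h1 h4
  · refine hle.trans ?_
    have : (0 : ℝ) ≤ (x ^ 2) ^ 0 / (((0 : ℕ).factorial : ℝ) * ((0 + j).factorial : ℝ)) := by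
      positivity
    rw [Finset.sum_range_one]
    linarith
  · have hf : ((m + (j + 1)).factorial : ℝ) = (m + j + 1) * ((m + j).factorial : ℝ) := by
      rw [← add_assoc, Nat.factorial_succ]; push_cast; ring
    have hf' : ((m + 1 + j).factorial : ℝ) = (m + j + 1) * ((m + j).factorial : ℝ) := by
      rw [add_right_comm, Nat.factorial_succ]; push_cast; ring
    have hg : ((m + 1).factorial : ℝ) = (m + 1) * (m.factorial : ℝ) := by
      rw [Nat.factorial_succ]; push_cast; ring
    rw [hf, hf', hg]
    have e1 : 1 / 2 * ((x ^ 2) ^ m / ((m.factorial : ℝ) * ((m + j).factorial : ℝ))) +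
        1 / 2 * ((x ^ 2) ^ (m + 1) / ((m + 1) * (m.factorial : ℝ) *
          ((m + j + 1) * ((m + j).factorial : ℝ)))) -
        x * ((x ^ 2) ^ m / ((m.factorial : ℝ) * ((m + j + 1) * ((m + j).factorial : ℝ)))) =
        (x ^ 2) ^ m / (2 * (m.factorial : ℝ) * ((m + j).factorial : ℝ) * (m + 1) * (m + j + 1)) *
          ((x - (m + 1)) ^ 2 + (m + 1) * j) := by
      field_simp
      ring
    have e2 : 0 ≤ (x ^ 2) ^ m / (2 * (m.factorial : ℝ) * ((m + j).factorial : ℝ) * (m + 1) *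
        (m + j + 1)) * ((x - (m + 1)) ^ 2 + (m + 1) * j) := by positivity
    linarith

/-- The ratio `I_{1+j}(2x) / I_1(2x)` of modified Bessel functions. -/
def besselRatio (x : ℝ) (j : ℕ) : ℝ :=
  x ^ j * besselCliffordReal (1 + j) (x ^ 2) / besselCliffordReal 1 (x ^ 2)

lemma hasSum_of_eq {f g : ℕ → ℂ} {a b : ℂ} (h : HasSum f a) (hfg : ∀ j, g j = f j) (hab : b = a) :
    HasSum g b := by
  rw [funext hfg, hab]
  exact h

lemma besselRatio_zero (x : ℝ) : besselRatio x 0 = 1 := by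
  have := (besselCliffordReal_pos 1 (sq_nonneg x)).ne'
  simp [besselRatio, this]

lemma besselRatio_nonneg {x : ℝ} (hx : 0 ≤ x) (j : ℕ) : 0 ≤ besselRatio x j := by
  have h1 := besselCliffordReal_pos 1 (sq_nonneg x)
  have h2 := besselCliffordReal_pos (1 + j) (sq_nonneg x)
  unfold besselRatio
  positivity

lemma besselRatio_succ_le {x : ℝ} (hx : 0 ≤ x) (j : ℕ) :
    besselRatio x (j + 1) ≤ besselRatio x j := by
  have h1 := besselCliffordReal_pos 1 (sq_nonneg x)
  have h2 := mul_besselCliffordReal_succ_le (1 + j) x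
  unfold besselRatio
  rw [← add_assoc, pow_succ, mul_assoc]
  gcongr

lemma besselRatio_le_one {x : ℝ} (hx : 0 ≤ x) (j : ℕ) : besselRatio x j ≤ 1 := by
  induction j with
  | zero => rw [besselRatio_zero]
  | succ j ih => exact (besselRatio_succ_le hx j).trans ih

lemma besselRatio_recurrence (x : ℝ) (j : ℕ) :
    x * (besselRatio x j - besselRatio x (j + 2)) = (j + 2) * besselRatio x (j + 1) := by
  have h := besselClifford_recurrence (1 + j) ((x ^ 2 : ℝ) : ℂ)
  simp only [besselClifford_ofReal] at h
  have h' : besselCliffordReal (1 + j) (x ^ 2) -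
      ((1 + j : ℕ) + 1) * besselCliffordReal (1 + j + 1) (x ^ 2) =
      x ^ 2 * besselCliffordReal (1 + j + 2) (x ^ 2) := by exact_mod_cast h
  unfold besselRatio
  rw [← add_assoc, ← add_assoc]
  rw [← sub_div, mul_div_assoc', mul_div_assoc', pow_add x j 2, pow_succ x j]
  congr 1
  push_cast at h'
  linear_combination x ^ j * x * h'

lemma mul_one_sub_besselRatio_le {x : ℝ} (hx : 0 ≤ x) (j : ℕ) :
    x * (1 - besselRatio x j) ≤ 4 ^ j - 1 := by
  induction j with
  | zero => simp [besselRatio_zero]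
  | succ j ih =>
    have h1 := besselRatio_recurrence x j
    have h2 := mul_le_mul_of_nonneg_left (besselRatio_succ_le hx (j + 1)) hx
    have h3 := mul_le_mul_of_nonneg_left (besselRatio_le_one hx (j + 1))
      (by positivity : (0 : ℝ) ≤ j + 2)
    have h4 : ((j + 1 : ℕ) : ℝ) ≤ ((4 ^ j : ℕ) : ℝ) :=
      Nat.cast_le.2 (Nat.lt_pow_self (by norm_num : 1 < 4))
    have h5 : (1 : ℝ) ≤ 4 ^ j := one_le_pow₀ (by norm_num)
    push_cast at h4
    rw [pow_succ]
    linarith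

open Filter Topology

lemma tendsto_besselRatio (j : ℕ) : Tendsto (fun x => besselRatio x j) atTop (𝓝 1) := by
  have h1 : Tendsto (fun x : ℝ => 1 - (4 ^ j - 1) / x) atTop (𝓝 (1 - 0)) :=
    tendsto_const_nhds.sub (tendsto_const_nhds.div_atTop tendsto_id)
  rw [sub_zero] at h1
  refine tendsto_of_tendsto_of_tendsto_of_le_of_le' h1 tendsto_const_nhds ?_ ?_
  · filter_upwards [eventually_gt_atTop 0] with x hx
    have h := mul_one_sub_besselRatio_le hx.le j
    rw [sub_le_comm, le_div_iff₀ hx]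
    linarith
  · filter_upwards [eventually_ge_atTop 0] with x hx
    exact besselRatio_le_one hx j

/-- The deviation of `x (1 - I₂(2x)/I₁(2x))` from its limit. -/
def besselDefect (x : ℝ) : ℝ := x * (1 - besselRatio x 1) - 3 / 4

lemma abs_besselDefect_le {x : ℝ} (hx : 0 ≤ x) : |besselDefect x| ≤ 4 := by
  have h1 := mul_one_sub_besselRatio_le hx 1
  have h2 := mul_nonneg hx (sub_nonneg.2 (besselRatio_le_one hx 1))
  unfold besselDefect
  rw [abs_le]
  constructor <;> linarith

lemma tendsto_mul_one_sub_besselRatio (j : ℕ) :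
    Tendsto (fun x => (1 - (-1) ^ j) / 2 * besselDefect x - x * (1 - besselRatio x j)) atTop
      (𝓝 (-(j * (j + 2) / 4))) := by
  induction j using Nat.twoStepInduction with
  | zero => simp [besselRatio_zero]
  | one =>
    refine tendsto_const_nhds.congr fun x => ?_
    simp only [besselDefect]; push_cast; ring
  | more j ih _ =>
    have h := ih.sub ((tendsto_besselRatio (j + 1)).const_mul ((j : ℝ) + 2))
    refine (h.congr fun x => ?_).trans_eq ?_
    · rw [← besselRatio_recurrence, pow_add]; ring
    · congr 1; push_cast; ring

lemma norm_pow_sub_pow_le_of_near {u w : ℂ} {x M : ℝ} (hM : 1 ≤ M) (hx : 1 ≤ x) (hu : ‖u‖ ≤ M)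
    (hw : ‖w‖ ≤ M) (j : ℕ) :
    ‖(x : ℂ) * ((u + w / x) ^ j - u ^ j)‖ ≤ (4 * M) ^ j := by
  have hx0 : (x : ℂ) ≠ 0 := by exact_mod_cast (by linarith : x ≠ 0)
  have hy : ‖u + w / x‖ ≤ 2 * M := by
    refine (norm_add_le _ _).trans ?_
    rw [norm_div, Complex.norm_real, Real.norm_of_nonneg (by linarith)]
    have : ‖w‖ / x ≤ ‖w‖ := div_le_self (norm_nonneg _) hx
    linarith
  induction j with
  | zero => simp
  | succ j ih =>
    have e : (x : ℂ) * ((u + w / x) ^ (j + 1) - u ^ (j + 1)) =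
        (u + w / x) * (x * ((u + w / x) ^ j - u ^ j)) + w * u ^ j := by
      have hxw : (x : ℂ) * (w / x) = w := mul_div_cancel₀ _ hx0
      linear_combination u ^ j * hxw
    rw [e]
    refine (norm_add_le _ _).trans ?_
    rw [norm_mul (u + w / x), norm_mul w, norm_pow]
    have h1 : ‖u‖ ^ j ≤ (4 * M) ^ j := pow_le_pow_left₀ (norm_nonneg _) (by linarith) j
    calc ‖u + w / x‖ * ‖(x : ℂ) * ((u + w / x) ^ j - u ^ j)‖ + ‖w‖ * ‖u‖ ^ j
        ≤ 2 * M * (4 * M) ^ j + M * (4 * M) ^ j := by gcongr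
      _ ≤ (4 * M) ^ (j + 1) := by
        rw [pow_succ]
        nlinarith [pow_pos (by linarith : 0 < 4 * M) j]

lemma tendsto_mul_pow_sub_pow {u w₀ : ℂ} {w : ℝ → ℂ} (hw : Tendsto w atTop (𝓝 w₀)) (j : ℕ) :
    Tendsto (fun x : ℝ => (x : ℂ) * ((u + w x / x) ^ j - u ^ j)) atTop
      (𝓝 (j * u ^ (j - 1) * w₀)) := by
  have hinv : Tendsto (fun x : ℝ => ((x : ℂ))⁻¹) atTop (𝓝 0) := by
    have := (Complex.continuous_ofReal.tendsto 0).comp tendsto_inv_atTop_zero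
    simpa [Function.comp_def] using this
  have hy : Tendsto (fun x : ℝ => u + w x / x) atTop (𝓝 u) := by
    have := (hw.mul hinv).const_add u
    simpa [div_eq_mul_inv] using this
  induction j with
  | zero => simp
  | succ j ih =>
    have h := (hy.mul ih).add (hw.mul_const (u ^ j))
    refine (h.congr' ?_).trans_eq ?_
    · filter_upwards [eventually_gt_atTop 0] with x hx
      have hx0 : (x : ℂ) ≠ 0 := by exact_mod_cast hx.ne'
      have hxw : (x : ℂ) * (w x / x) = w x := mul_div_cancel₀ _ hx0
      linear_combination -u ^ j * hxw
    · congr 1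
      rcases j with _ | j
      · simp
      · simp only [Nat.add_sub_cancel]; push_cast; ring

lemma hasSum_exp_div_factorial (u : ℂ) :
    HasSum (fun j : ℕ => u ^ j / (j.factorial : ℂ)) (Complex.exp u) := by
  rw [Complex.exp_eq_exp_ℂ]
  exact NormedSpace.expSeries_div_hasSum_exp u

lemma hasSum_natCast_mul_pow_div_factorial (u : ℂ) :
    HasSum (fun j : ℕ => (j : ℂ) * u ^ (j - 1) / (j.factorial : ℂ)) (Complex.exp u) := by
  rw [← hasSum_nat_add_iff' 1]
  simp only [Finset.sum_range_one, Nat.cast_zero, zero_mul, zero_div, sub_zero]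
  refine hasSum_of_eq (hasSum_exp_div_factorial u) (fun j => ?_) rfl
  rw [Nat.factorial_succ]
  have := Nat.cast_ne_zero (R := ℂ).2 j.factorial_ne_zero
  have h2 : ((j : ℂ) + 1) ≠ 0 := by exact_mod_cast j.succ_ne_zero
  push_cast
  field_simp

lemma hasSum_natCast_mul_pred_mul_pow_div_factorial (u : ℂ) :
    HasSum (fun j : ℕ => (j : ℂ) * (j - 1) * u ^ j / (j.factorial : ℂ))
      (u ^ 2 * Complex.exp u) := by
  rw [← hasSum_nat_add_iff' 2]
  refine hasSum_of_eq ((hasSum_exp_div_factorial u).mul_left (u ^ 2)) (fun j => ?_)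
    (by simp [Finset.sum_range_succ])
  rw [Nat.factorial_succ, Nat.factorial_succ]
  have := Nat.cast_ne_zero (R := ℂ).2 j.factorial_ne_zero
  have h2 : ((j : ℂ) + 1) ≠ 0 := by exact_mod_cast j.succ_ne_zero
  have h3 : ((j : ℂ) + 1 + 1) ≠ 0 := by exact_mod_cast (j + 1).succ_ne_zero
  push_cast
  field_simp
  ring

lemma hasSum_second_order (u w₀ : ℂ) :
    HasSum (fun j : ℕ => (j * u ^ (j - 1) * w₀ + (-(j * (j + 2) / 4)) * u ^ j) /
      (j.factorial : ℂ)) ((w₀ - (u ^ 2 + 3 * u) / 4) * Complex.exp u) := by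
  have h1 := hasSum_natCast_mul_pow_div_factorial u
  have h2 := hasSum_natCast_mul_pred_mul_pow_div_factorial u
  refine hasSum_of_eq (((h1.mul_right w₀).sub (h1.mul_right (3 * u / 4))).sub
    (h2.mul_right (1 / 4))) (fun j => ?_) (by ring)
  · rcases j with _ | j
    · simp
    · rw [Nat.add_sub_cancel, pow_succ]; push_cast; ring

lemma hasSum_besselRatio {x : ℝ} (y : ℂ) :
    HasSum (fun j : ℕ => (besselRatio x j : ℂ) * y ^ j / (j.factorial : ℂ))
      (besselClifford 1 ((x : ℂ) ^ 2 + x * y) / besselClifford 1 ((x : ℂ) ^ 2)) := by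
  have h := (hasSum_besselClifford_add 1 ((x : ℂ) ^ 2) (x * y)).div_const
    (besselClifford 1 ((x : ℂ) ^ 2))
  refine hasSum_of_eq h (fun j => ?_) rfl
  have hcast : (x : ℂ) ^ 2 = ((x ^ 2 : ℝ) : ℂ) := by push_cast; rfl
  rw [besselRatio, hcast, besselClifford_ofReal, besselClifford_ofReal]
  push_cast
  ring

/-- The terms of the rescaled remainder in the large-argument expansion. -/
def remainderTerm (u w : ℂ) (x : ℝ) (j : ℕ) : ℂ :=
  ((besselRatio x j : ℂ) * (x * ((u + w / x) ^ j - u ^ j)) +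
    (((1 - (-1) ^ j) / 2 * besselDefect x - x * (1 - besselRatio x j) : ℝ) : ℂ) * u ^ j) /
    (j.factorial : ℂ)

lemma hasSum_remainderTerm (u w : ℂ) (x : ℝ) :
    HasSum (remainderTerm u w x)
      (x * (besselClifford 1 ((x : ℂ) ^ 2 + x * (u + w / x)) / besselClifford 1 ((x : ℂ) ^ 2) -
        Complex.exp u) + besselDefect x * ((Complex.exp u - Complex.exp (-u)) / 2)) := by
  have h1 := hasSum_besselRatio (x := x) (u + w / x)
  have h2 := hasSum_exp_div_factorial u
  have h3 := hasSum_exp_div_factorial (-u)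
  refine hasSum_of_eq (((h1.sub h2).mul_left (x : ℂ)).add (((h2.sub h3).div_const 2).mul_left
    (besselDefect x : ℂ))) (fun j => ?_) rfl
  rw [remainderTerm, neg_pow]
  push_cast
  ring

lemma norm_remainderTerm_le {u w : ℂ} {x M : ℝ} (hM : 1 ≤ M) (hx : 1 ≤ x) (hu : ‖u‖ ≤ M)
    (hw : ‖w‖ ≤ M) (j : ℕ) :
    ‖remainderTerm u w x j‖ ≤ 6 * ((4 * M) ^ j / (j.factorial : ℝ)) := by
  have hx0 : 0 ≤ x := by linarith
  rw [remainderTerm, norm_div, Complex.norm_natCast, ← mul_div_assoc]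
  gcongr
  refine (norm_add_le _ _).trans ?_
  rw [norm_mul (besselRatio x j : ℂ), norm_mul _ (u ^ j), norm_pow, Complex.norm_real,
    Complex.norm_real,
    Real.norm_of_nonneg (besselRatio_nonneg hx0 j), Real.norm_eq_abs]
  have h1 := norm_pow_sub_pow_le_of_near hM hx hu hw j
  have h2 := besselRatio_le_one hx0 j
  have h3 := mul_one_sub_besselRatio_le hx0 j
  have h4 := mul_nonneg hx0 (sub_nonneg.2 (besselRatio_le_one hx0 j))
  have h5 : |(1 - (-1) ^ j) / 2 * besselDefect x - x * (1 - besselRatio x j)| ≤ 5 * 4 ^ j := by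
    have h6 := abs_le.1 (abs_besselDefect_le hx0)
    have h7 : (1 : ℝ) ≤ 4 ^ j := one_le_pow₀ (by norm_num)
    rcases neg_one_pow_eq_or ℝ j with h | h <;> rw [h, abs_le] <;> constructor <;> linarith
  have h8 : ‖u‖ ^ j ≤ M ^ j := pow_le_pow_left₀ (norm_nonneg _) hu j
  calc besselRatio x j * ‖(x : ℂ) * ((u + w / x) ^ j - u ^ j)‖ +
        |(1 - (-1) ^ j) / 2 * besselDefect x - x * (1 - besselRatio x j)| * ‖u‖ ^ j
      ≤ 1 * (4 * M) ^ j + 5 * 4 ^ j * M ^ j := by gcongr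
    _ = 6 * (4 * M) ^ j := by rw [mul_pow]; ring

lemma summable_remainder_bound (M : ℝ) :
    HasSum (fun j : ℕ => 6 * ((4 * M) ^ j / (j.factorial : ℝ))) (6 * Real.exp (4 * M)) := by
  rw [Real.exp_eq_exp_ℝ]
  exact (NormedSpace.expSeries_div_hasSum_exp (4 * M)).mul_left 6

/-- The rescaled remainder in the large-argument expansion of `besselClifford 1`. -/
def besselRemainder (u w : ℂ) (x : ℝ) : ℂ :=
  x * (besselClifford 1 ((x : ℂ) ^ 2 + x * (u + w / x)) / besselClifford 1 ((x : ℂ) ^ 2) -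
    Complex.exp u) + besselDefect x * ((Complex.exp u - Complex.exp (-u)) / 2)

lemma norm_besselRemainder_le {u w : ℂ} {x M : ℝ} (hM : 1 ≤ M) (hx : 1 ≤ x) (hu : ‖u‖ ≤ M)
    (hw : ‖w‖ ≤ M) : ‖besselRemainder u w x‖ ≤ 6 * Real.exp (4 * M) := by
  rw [besselRemainder, ← (hasSum_remainderTerm u w x).tsum_eq]
  exact tsum_of_norm_bounded (summable_remainder_bound M)
    (norm_remainderTerm_le hM hx hu hw)

lemma tendsto_besselRemainder {u w₀ : ℂ} {w : ℝ → ℂ} (hw : Tendsto w atTop (𝓝 w₀)) :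
    Tendsto (fun x => besselRemainder u (w x) x) atTop
      (𝓝 ((w₀ - (u ^ 2 + 3 * u) / 4) * Complex.exp u)) := by
  rw [← (hasSum_second_order u w₀).tsum_eq]
  simp_rw [besselRemainder, ← (hasSum_remainderTerm u _ _).tsum_eq]
  set M := max 1 (max ‖u‖ (‖w₀‖ + 1)) with hMdef
  have hM : 1 ≤ M := le_max_left _ _
  have hu : ‖u‖ ≤ M := (le_max_left _ _).trans (le_max_right _ _)
  have hw0 : ‖w₀‖ + 1 ≤ M := (le_max_right _ _).trans (le_max_right _ _)
  refine tendsto_tsum_of_dominated_convergence (summable_remainder_bound M).summable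
    (fun j => ?_) ?_
  · have h1 := (Complex.continuous_ofReal.tendsto _).comp (tendsto_besselRatio j)
    have h2 := (Complex.continuous_ofReal.tendsto _).comp (tendsto_mul_one_sub_besselRatio j)
    have h3 := tendsto_mul_pow_sub_pow (u := u) hw j
    have h4 := ((h1.mul h3).add (h2.mul_const (u ^ j))).div_const (j.factorial : ℂ)
    refine h4.trans_eq ?_
    congr 2
    push_cast
    ring
  · filter_upwards [eventually_ge_atTop 1, hw.norm.eventually_le_const
      (by linarith : ‖w₀‖ < ‖w₀‖ + 1)] with x hx hwx j
    exact norm_remainderTerm_le hM hx hu (hwx.trans hw0) j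

lemma second_order_of_integral_eventually_zero {n : ℤ} {p r : ℂ} {w : ℝ → ℝ → ℂ} {w₀ : ℝ → ℂ}
    {B : ℝ} (hwc : ∀ x, Continuous (w x)) (hwB : ∀ᶠ x in atTop, ∀ α, ‖w x α‖ ≤ B)
    (hw : ∀ α, Tendsto (fun x => w x α) atTop (𝓝 (w₀ α)))
    (hzero : ∀ᶠ x : ℝ in atTop, ∫ α in (-Real.pi)..Real.pi, circlePt α ^ n *
      besselClifford 1 ((x : ℂ) ^ 2 + x * ((p * circlePt α + r * (circlePt α)⁻¹) + w x α / x)) = 0) :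
    expMoment n p r = 0 ∧
    ∫ α in (-Real.pi)..Real.pi, circlePt α ^ n * ((w₀ α - ((p * circlePt α + r * (circlePt α)⁻¹) ^ 2
      + 3 * (p * circlePt α + r * (circlePt α)⁻¹)) / 4) *
        Complex.exp (p * circlePt α + r * (circlePt α)⁻¹)) = 0 := by
  set u : ℝ → ℂ := fun α => p * circlePt α + r * (circlePt α)⁻¹ with hu
  have huc : Continuous u := by fun_prop
  set L : ℂ := ∫ α in (-Real.pi)..Real.pi, circlePt α ^ n *
    ((w₀ α - (u α ^ 2 + 3 * u α) / 4) * Complex.exp (u α)) with hL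
  have hrc : ∀ x : ℝ, Continuous fun α => besselRemainder (u α) (w x α) x := by
    intro x
    have := hwc x
    unfold besselRemainder
    fun_prop
  have hlim : Tendsto (fun x : ℝ => ∫ α in (-Real.pi)..Real.pi, circlePt α ^ n *
      besselRemainder (u α) (w x α) x) atTop (𝓝 L) := by
    set M := max 1 (max (‖p‖ + ‖r‖) B) with hMdef
    have hM : 1 ≤ M := le_max_left _ _
    have huM : ∀ α, ‖u α‖ ≤ M := by
      intro α
      refine le_trans ?_ ((le_max_left (‖p‖ + ‖r‖) B).trans (le_max_right _ _))
      refine (norm_add_le _ _).trans ?_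
      simp [norm_circlePt]
    have hBM : B ≤ M := (le_max_right _ _).trans (le_max_right _ _)
    refine intervalIntegral.tendsto_integral_filter_of_dominated_convergence
      (fun _ => 6 * Real.exp (4 * M)) ?_ ?_ (by simp) ?_
    · filter_upwards with x
      have := hrc x
      exact Continuous.aestronglyMeasurable (by fun_prop)
    · filter_upwards [hwB, eventually_ge_atTop 1] with x hx hx1
      filter_upwards with α _
      rw [norm_mul, norm_zpow, norm_circlePt, one_zpow, one_mul]
      exact norm_besselRemainder_le hM hx1 (huM α) ((hx α).trans hBM)
    · filter_upwards with α _
      exact (tendsto_besselRemainder (hw α)).const_mul _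
  set c := expMoment n p r with hc
  have hval : ∀ᶠ x : ℝ in atTop, ∫ α in (-Real.pi)..Real.pi, circlePt α ^ n *
      besselRemainder (u α) (w x α) x =
      c * (-x + besselDefect x * ((1 - (-1) ^ n) / 2)) := by
    filter_upwards [hzero] with x hx
    have hneg : ∫ α in (-Real.pi)..Real.pi, circlePt α ^ n * Complex.exp (-u α) =
        (-1) ^ n * c := by
      rw [hc, ← expMoment_neg_neg, expMoment]
      congr 1; funext α
      simp only [hu]
      congr 2; ring
    have hsplit : ∀ α, circlePt α ^ n * besselRemainder (u α) (w x α) x =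
        x / besselClifford 1 ((x : ℂ) ^ 2) * (circlePt α ^ n *
          besselClifford 1 ((x : ℂ) ^ 2 + x * (u α + w x α / x))) +
        (-x + besselDefect x / 2) * (circlePt α ^ n * Complex.exp (u α)) -
        besselDefect x / 2 * (circlePt α ^ n * Complex.exp (-u α)) := by
      intro α
      rw [besselRemainder]
      ring
    have hwx := hwc x
    simp_rw [hsplit]
    rw [intervalIntegral.integral_sub, intervalIntegral.integral_add,
      intervalIntegral.integral_const_mul, intervalIntegral.integral_const_mul,
      intervalIntegral.integral_const_mul, hx, hneg]
    · change _ + _ * c - _ = _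
      ring
    all_goals exact Continuous.intervalIntegrable (by fun_prop) _ _
  have hlim' := hlim.congr' hval
  have hinv : Tendsto (fun x : ℝ => (x : ℂ)⁻¹) atTop (𝓝 0) := by
    have := (Complex.continuous_ofReal.tendsto 0).comp tendsto_inv_atTop_zero
    simpa [Function.comp_def] using this
  have hdef : Tendsto (fun x : ℝ => (x : ℂ)⁻¹ * besselDefect x) atTop (𝓝 0) := by
    refine hinv.zero_mul_isBoundedUnder_le ?_
    refine isBoundedUnder_of_eventually_le (a := 4) ?_
    filter_upwards [eventually_ge_atTop 0] with x hx
    simpa using abs_besselDefect_le hx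
  have hc0 : c = 0 := by
    have h1 := hinv.mul hlim'
    have h2 := ((hdef.mul_const ((1 - (-1) ^ n) / 2)).const_add (-1)).const_mul c
    have h3 := tendsto_nhds_unique (h1.congr' ?_) h2
    · simpa using h3
    · filter_upwards [eventually_gt_atTop 0] with x hx
      have hx0 : (x : ℂ) ≠ 0 := by exact_mod_cast hx.ne'
      field_simp
  refine ⟨hc0, ?_⟩
  rw [hc0] at hlim'
  simp only [zero_mul] at hlim'
  exact tendsto_nhds_unique hlim' tendsto_const_nhds

lemma integral_mul_besselClifford_zero (t : ℂ) :
    ∫ ρ in (0 : ℝ)..1, (ρ : ℂ) * besselClifford 0 ((ρ : ℂ) ^ 2 * t) = besselClifford 1 t / 2 := by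
  have h : HasSum (fun m : ℕ => ∫ ρ in (0 : ℝ)..1, (ρ : ℂ) * (((ρ : ℂ) ^ 2 * t) ^ m /
      ((m.factorial : ℂ) * ((m + 0).factorial : ℂ))))
      (∫ ρ in (0 : ℝ)..1, (ρ : ℂ) * besselClifford 0 ((ρ : ℂ) ^ 2 * t)) := by
    refine intervalIntegral.hasSum_integral_of_dominated_convergence
      (fun (m : ℕ) _ => ‖t‖ ^ m / ((m.factorial : ℝ) * ((m + 0).factorial : ℝ)))
      (fun m => ?_) (fun m => ?_) ?_ (by simp) ?_
    · exact Continuous.aestronglyMeasurable (by fun_prop)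
    · filter_upwards with ρ hρ
      rw [Set.uIoc_of_le zero_le_one] at hρ
      have h1 : ‖(ρ : ℂ)‖ ≤ 1 := by
        rw [Complex.norm_real, Real.norm_of_nonneg hρ.1.le]; exact hρ.2
      rw [norm_mul, norm_div, norm_mul, norm_pow, norm_mul, norm_pow, Complex.norm_natCast,
        Complex.norm_natCast, ← mul_div_assoc]
      gcongr
      calc ‖(ρ : ℂ)‖ * (‖(ρ : ℂ)‖ ^ 2 * ‖t‖) ^ m ≤ 1 * (1 ^ 2 * ‖t‖) ^ m := by gcongr
        _ = ‖t‖ ^ m := by simp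
    · filter_upwards with ρ _
      exact (hasSum_besselCliffordReal 0 ‖t‖).summable
    · filter_upwards with ρ _
      exact (hasSum_besselClifford 0 _).mul_left _
  refine (h.unique (hasSum_of_eq ((hasSum_besselClifford 1 t).div_const 2) (fun m => ?_) rfl))
  have e : ∀ ρ : ℝ, (ρ : ℂ) * (((ρ : ℂ) ^ 2 * t) ^ m /
      ((m.factorial : ℂ) * ((m + 0).factorial : ℂ))) =
      t ^ m / ((m.factorial : ℂ) * (m.factorial : ℂ)) * (((ρ ^ (2 * m + 1) : ℝ)) : ℂ) := by
    intro ρ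
    push_cast
    rw [mul_pow, ← pow_mul, pow_succ, add_zero]
    ring
  simp_rw [e]
  rw [intervalIntegral.integral_const_mul, intervalIntegral.integral_ofReal, integral_pow,
    Nat.factorial_succ]
  have h1 : (m.factorial : ℂ) ≠ 0 := by exact_mod_cast m.factorial_ne_zero
  have h2 : ((m : ℂ) + 1) ≠ 0 := by exact_mod_cast m.succ_ne_zero
  have h3 : (2 * (m : ℂ) + 1 + 1) ≠ 0 := by exact_mod_cast (2 * m + 1).succ_ne_zero
  push_cast
  simp only [one_pow, ne_eq, Nat.add_eq_zero_iff, one_ne_zero, and_false, not_false_eq_true,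
    zero_pow, sub_zero]
  field_simp
  ring

lemma integral_disc_exp (s t : ℂ) :
    ∫ p in {p : ℝ × ℝ | p.1 ^ 2 + p.2 ^ 2 < 1}, Complex.exp (s * (p.1 : ℂ) + t * (p.2 : ℂ)) =
      (Real.pi : ℂ) * besselClifford 1 ((s ^ 2 + t ^ 2) / 4) := by
  have hmeas : MeasurableSet {p : ℝ × ℝ | p.1 ^ 2 + p.2 ^ 2 < 1} :=
    (isOpen_lt (by fun_prop) continuous_const).measurableSet
  set g : ℝ × ℝ → ℂ := fun p => (p.1 : ℂ) * Complex.exp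
    ((p.1 * ((s - Complex.I * t) / 2)) * circlePt p.2 +
      (p.1 * ((s + Complex.I * t) / 2)) * (circlePt p.2)⁻¹) with hg
  have hgc : Continuous g := by
    have h1 : Continuous fun x : ℝ × ℝ => circlePt x.2 := continuous_circlePt.comp continuous_snd
    have h2 : Continuous fun x : ℝ × ℝ => (circlePt x.2)⁻¹ :=
      continuous_circlePt_inv.comp continuous_snd
    fun_prop
  have hset : polarCoord.target ∩ {p : ℝ × ℝ | p.1 < 1} =
      Set.Ioo 0 1 ×ˢ Set.Ioo (-Real.pi) Real.pi := by
    ext p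
    simp only [polarCoord_target, Set.mem_inter_iff, Set.mem_prod, Set.mem_Ioi, Set.mem_Ioo,
      Set.mem_ofPred_eq]
    tauto
  have hpolar : ∫ p in {p : ℝ × ℝ | p.1 ^ 2 + p.2 ^ 2 < 1},
      Complex.exp (s * (p.1 : ℂ) + t * (p.2 : ℂ)) =
      ∫ p in Set.Ioo (0 : ℝ) 1 ×ˢ Set.Ioo (-Real.pi) Real.pi, g p := by
    rw [← integral_indicator hmeas, ← integral_comp_polarCoord_symm, ← hset,
      ← setIntegral_indicator (measurableSet_lt measurable_fst measurable_const)]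
    refine setIntegral_congr_fun polarCoord.open_target.measurableSet fun p hp => ?_
    have hp0 : 0 < p.1 := by
      rw [polarCoord_target] at hp; exact hp.1
    have hiff : polarCoord.symm p ∈ {p : ℝ × ℝ | p.1 ^ 2 + p.2 ^ 2 < 1} ↔
        p ∈ {p : ℝ × ℝ | p.1 < 1} := by
      simp only [polarCoord_symm_apply, Set.mem_ofPred_eq]
      have : (p.1 * Real.cos p.2) ^ 2 + (p.1 * Real.sin p.2) ^ 2 = p.1 ^ 2 := by
        linear_combination p.1 ^ 2 * Real.sin_sq_add_cos_sq p.2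
      rw [this, sq_lt_one_iff₀ hp0.le]
    by_cases h : p ∈ {p : ℝ × ℝ | p.1 < 1}
    · simp only [Set.indicator_of_mem h, Set.indicator_of_mem (hiff.2 h)]
      rw [Complex.real_smul]
      simp only [hg, polarCoord_symm_apply]
      rw [circlePt_inv_eq, circlePt_eq]
      congr 2
      push_cast
      linear_combination ((p.1 : ℂ) * t * Complex.sin p.2) * Complex.I_sq
    · simp only [Set.indicator_of_notMem h, Set.indicator_of_notMem (mt hiff.1 h), smul_zero]
  rw [hpolar]
  have hint : IntegrableOn g (Set.Ioo (0 : ℝ) 1 ×ˢ Set.Ioo (-Real.pi) Real.pi)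
      (volume.prod volume) :=
    (hgc.continuousOn.integrableOn_compact (isCompact_Icc.prod isCompact_Icc)).mono_set
      (Set.prod_mono Set.Ioo_subset_Icc_self Set.Ioo_subset_Icc_self)
  rw [Measure.volume_eq_prod, setIntegral_prod g hint]
  have hinner : ∀ ρ : ℝ, ∫ θ in Set.Ioo (-Real.pi) Real.pi, g (ρ, θ) =
      2 * (Real.pi : ℂ) * ((ρ : ℂ) * besselClifford 0 ((ρ : ℂ) ^ 2 * ((s ^ 2 + t ^ 2) / 4))) := by
    intro ρ
    rw [← integral_Ioc_eq_integral_Ioo, ← intervalIntegral.integral_of_le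
      (by linarith [Real.pi_pos])]
    have h := expMoment_natCast 0 (ρ * ((s - Complex.I * t) / 2)) (ρ * ((s + Complex.I * t) / 2))
    have e : (ρ : ℂ) * ((s - Complex.I * t) / 2) * (ρ * ((s + Complex.I * t) / 2)) =
        (ρ : ℂ) ^ 2 * ((s ^ 2 + t ^ 2) / 4) := by
      linear_combination (-(ρ : ℂ) ^ 2 * t ^ 2 / 4) * Complex.I_sq
    rw [e] at h
    simp only [hg]
    rw [intervalIntegral.integral_const_mul]
    simp only [expMoment, Nat.cast_zero, zpow_zero, one_mul, pow_zero, mul_one] at h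
    rw [h]
    ring
  simp_rw [hinner]
  rw [← integral_Ioc_eq_integral_Ioo, ← intervalIntegral.integral_of_le zero_le_one,
    intervalIntegral.integral_const_mul, integral_mul_besselClifford_zero]
  ring

lemma integral_ellipse_exp {a b : ℝ} (ha : 0 < a) (hb : 0 < b) (s t : ℂ) :
    ∫ p in {p : ℝ × ℝ | p.1 ^ 2 / a ^ 2 + p.2 ^ 2 / b ^ 2 < 1},
      Complex.exp (s * (p.1 : ℂ) + t * (p.2 : ℂ)) =
      (a : ℂ) * b * Real.pi * besselClifford 1 (((a * s) ^ 2 + (b * t) ^ 2) / 4) := by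
  set f : ℝ × ℝ →L[ℝ] ℝ × ℝ := (a • ContinuousLinearMap.id ℝ ℝ).prodMap
    (b • ContinuousLinearMap.id ℝ ℝ) with hf
  have hfa : ∀ p : ℝ × ℝ, f p = (a * p.1, b * p.2) := by 
    intro p
    rfl
  have hdet : f.det = a * b := by
    rw [ContinuousLinearMap.det]
    have : (f : ℝ × ℝ →ₗ[ℝ] ℝ × ℝ) = (a • LinearMap.id).prodMap (b • LinearMap.id) := rfl
    rw [this, LinearMap.det_prodMap, LinearMap.det_smul, LinearMap.det_smul]
    simp
  have himage : f '' {p : ℝ × ℝ | p.1 ^ 2 + p.2 ^ 2 < 1} =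
      {p : ℝ × ℝ | p.1 ^ 2 / a ^ 2 + p.2 ^ 2 / b ^ 2 < 1} := by
    ext p
    simp only [Set.mem_image, Set.mem_ofPred_eq, hfa]
    constructor
    · rintro ⟨y, hy, rfl⟩
      simp only [mul_pow]
      rwa [mul_div_cancel_left₀ _ (by positivity), mul_div_cancel_left₀ _ (by positivity)]
    · intro hp
      refine ⟨(p.1 / a, p.2 / b), by simpa [div_pow] using hp, ?_⟩
      ext
      · simp only; field_simp
      · simp only; field_simp
  have hmeas : MeasurableSet {p : ℝ × ℝ | p.1 ^ 2 + p.2 ^ 2 < 1} :=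
    (isOpen_lt (by fun_prop) continuous_const).measurableSet
  have hinj : Set.InjOn f {p : ℝ × ℝ | p.1 ^ 2 + p.2 ^ 2 < 1} := by
    intro x _ y _ hxy
    rw [hfa, hfa, Prod.mk.injEq] at hxy
    exact Prod.ext (mul_left_cancel₀ ha.ne' hxy.1) (mul_left_cancel₀ hb.ne' hxy.2)
  rw [← himage, integral_image_eq_integral_abs_det_fderiv_smul volume hmeas
    (fun x _ => f.hasFDerivAt.hasFDerivWithinAt) hinj, hdet, abs_of_pos (mul_pos ha hb)]
  rw [integral_smul, Complex.real_smul]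
  have hint : ∀ p : ℝ × ℝ, Complex.exp (s * ((f p).1 : ℂ) + t * ((f p).2 : ℂ)) =
      Complex.exp ((a * s) * (p.1 : ℂ) + (b * t) * (p.2 : ℂ)) := by
    intro p
    rw [hfa]
    congr 1; push_cast; ring
  simp_rw [hint]
  rw [integral_disc_exp]
  push_cast
  ring

lemma ellipse_subset {a b : ℝ} (ha : 0 < a) (hb : 0 < b) :
    {p : ℝ × ℝ | p.1 ^ 2 / a ^ 2 + p.2 ^ 2 / b ^ 2 < 1} ⊆ Set.Icc (-a) a ×ˢ Set.Icc (-b) b := by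
  intro p hp
  simp only [Set.mem_ofPred_eq] at hp
  have h1 : 0 ≤ p.1 ^ 2 / a ^ 2 := by positivity
  have h2 : 0 ≤ p.2 ^ 2 / b ^ 2 := by positivity
  refine ⟨abs_le.1 (abs_le_of_sq_le_sq ?_ ha.le), abs_le.1 (abs_le_of_sq_le_sq ?_ hb.le)⟩
  · have := (div_lt_one (by positivity)).1 (by linarith : p.1 ^ 2 / a ^ 2 < 1)
    linarith
  · have := (div_lt_one (by positivity)).1 (by linarith : p.2 ^ 2 / b ^ 2 < 1)
    linarith

/-- Pairing a Herglotz wave on an ellipse with an exponential. -/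
lemma integral_ellipse_herglotzH {a b : ℝ} (ha : 0 < a) (hb : 0 < b) (n : ℤ) (k : ℝ) (s t : ℂ) :
    ∫ p in {p : ℝ × ℝ | p.1 ^ 2 / a ^ 2 + p.2 ^ 2 / b ^ 2 < 1},
      herglotzH n k p * Complex.exp (s * (p.1 : ℂ) + t * (p.2 : ℂ)) =
    (a : ℂ) * b * Real.pi * ∫ α in (-Real.pi)..Real.pi, circlePt α ^ n * besselClifford 1
      (((a * (s + Complex.I * k * (Real.cos α : ℂ))) ^ 2 +
        (b * (t + Complex.I * k * (Real.sin α : ℂ))) ^ 2) / 4) := by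
  set D := {p : ℝ × ℝ | p.1 ^ 2 / a ^ 2 + p.2 ^ 2 / b ^ 2 < 1} with hD
  set F : ℝ → ℝ × ℝ → ℂ := fun α p => circlePt α ^ n *
    Complex.exp ((s + Complex.I * k * (Real.cos α : ℂ)) * (p.1 : ℂ) +
      (t + Complex.I * k * (Real.sin α : ℂ)) * (p.2 : ℂ)) with hF
  have hFc : Continuous (Function.uncurry F) := by
    have h1 : Continuous fun x : ℝ × (ℝ × ℝ) => circlePt x.1 ^ n :=
      (continuous_circlePt_zpow n).comp continuous_fst
    unfold Function.uncurry
    fun_prop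
  have hint : Integrable (Function.uncurry F)
      ((volume.restrict (Set.uIoc (-Real.pi) Real.pi)).prod (volume.restrict D)) := by
    rw [Measure.prod_restrict]
    refine (hFc.continuousOn.integrableOn_compact (isCompact_uIcc.prod
      (isCompact_Icc.prod isCompact_Icc))).mono_set
      (Set.prod_mono Set.uIoc_subset_uIcc (ellipse_subset ha hb))
  have hswap := intervalIntegral_integral_swap hint
  have hleft : ∀ p : ℝ × ℝ, herglotzH n k p * Complex.exp (s * (p.1 : ℂ) + t * (p.2 : ℂ)) =
      ∫ α in (-Real.pi)..Real.pi, F α p := by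
    intro p
    rw [herglotzH, ← intervalIntegral.integral_mul_const]
    congr 1; funext α
    simp only [hF]
    rw [circlePt_zpow, mul_assoc, ← Complex.exp_add]
    congr 2; ring
  simp_rw [hleft]
  rw [← hswap, ← intervalIntegral.integral_const_mul]
  congr 1; funext α
  simp only [hF]
  rw [integral_const_mul, integral_ellipse_exp ha hb]
  ring

lemma besselJNat_eq (ν : ℕ) (z : ℂ) :
    besselJNat ν z = (z / 2) ^ ν * besselClifford ν (-(z / 2) ^ 2) := by
  rw [besselJNat, besselClifford, ← tsum_mul_left]
  congr 1; funext m
  rw [pow_add, pow_mul, neg_pow ((z / 2) ^ 2)]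
  ring

lemma besselJ_eq_zero_of_expMoment_eq_zero {n : ℤ} {p r z : ℂ} (hp : p ≠ 0) (hr : r ≠ 0)
    (hpr : p * r = -(z / 2) ^ 2) (h : expMoment n p r = 0) : besselJ n z = 0 := by
  have key : ∀ (m : ℕ) {p r : ℂ}, r ≠ 0 → p * r = -(z / 2) ^ 2 → expMoment m p r = 0 →
      besselJNat m z = 0 := by
    intro m p r hr hpr h
    rw [expMoment_natCast, hpr] at h
    have hpi : (2 * (Real.pi : ℂ)) ≠ 0 := by simp [Real.pi_ne_zero]
    rw [besselJNat_eq, (mul_eq_zero.1 h).resolve_left (mul_ne_zero hpi (pow_ne_zero m hr)),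
      mul_zero]
  unfold besselJ
  split_ifs with hn
  · refine key _ hr hpr ?_
    rwa [Int.toNat_of_nonneg hn]
  · rw [key (-n).toNat hp (by rwa [mul_comm]) ?_, mul_zero]
    rwa [Int.toNat_of_nonneg (by omega), expMoment_neg]

lemma tendsto_sqrt_sq_add_sub (A : ℝ) :
    Tendsto (fun t : ℝ => Real.sqrt (t ^ 2 + A ^ 2) - t) atTop (𝓝 0) := by
  have h1 : Tendsto (fun t : ℝ => A ^ 2 / t) atTop (𝓝 0) :=
    tendsto_const_nhds.div_atTop tendsto_id
  refine tendsto_of_tendsto_of_tendsto_of_le_of_le' tendsto_const_nhds h1 ?_ ?_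
  · filter_upwards [eventually_gt_atTop 0] with t ht
    exact sub_nonneg.2 (Real.le_sqrt_of_sq_le (by nlinarith [sq_nonneg A]))
  · filter_upwards [eventually_gt_atTop 0] with t ht
    rw [sub_le_iff_le_add]
    refine Real.sqrt_le_left (by positivity) |>.2 ?_
    have e : (A ^ 2 / t + t) ^ 2 = t ^ 2 + A ^ 2 + (A ^ 2 + (A ^ 2 / t) ^ 2) := by
      field_simp; ring
    rw [e]
    nlinarith [sq_nonneg A, sq_nonneg (A ^ 2 / t)]

lemma expMoment_relation {n : ℤ} {p r C K : ℂ} (hp : p ≠ 0) (hr : r ≠ 0)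
    (h0 : expMoment n p r = 0)
    (hI : ∫ α in (-Real.pi)..Real.pi, circlePt α ^ n *
      ((C + K * circlePt α ^ 2 - 3 / 4 * (p * circlePt α + r * (circlePt α)⁻¹)) *
        Complex.exp (p * circlePt α + r * (circlePt α)⁻¹)) = 0) :
    K * (n + 1) + 3 / 2 * p ^ 2 = 0 := by
  have hsplit : ∀ α, circlePt α ^ n *
      ((C + K * circlePt α ^ 2 - 3 / 4 * (p * circlePt α + r * (circlePt α)⁻¹)) *
        Complex.exp (p * circlePt α + r * (circlePt α)⁻¹)) =
      C * (circlePt α ^ n * Complex.exp (p * circlePt α + r * (circlePt α)⁻¹)) +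
      K * (circlePt α ^ (n + 1 + 1) * Complex.exp (p * circlePt α + r * (circlePt α)⁻¹)) -
      3 / 4 * p * (circlePt α ^ (n + 1) * Complex.exp (p * circlePt α + r * (circlePt α)⁻¹)) -
      3 / 4 * r * (circlePt α ^ (n - 1) * Complex.exp (p * circlePt α + r * (circlePt α)⁻¹)) := by
    intro α
    have hz := circlePt_ne_zero α
    rw [zpow_add_one₀ hz, zpow_add_one₀ hz, zpow_sub_one₀ hz]
    ring
  simp_rw [hsplit] at hI
  rw [intervalIntegral.integral_sub, intervalIntegral.integral_sub,
    intervalIntegral.integral_add, intervalIntegral.integral_const_mul,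
    intervalIntegral.integral_const_mul, intervalIntegral.integral_const_mul,
    intervalIntegral.integral_const_mul] at hI
  · change C * expMoment n p r + K * expMoment (n + 1 + 1) p r -
      3 / 4 * p * expMoment (n + 1) p r - 3 / 4 * r * expMoment (n - 1) p r = 0 at hI
    have h1 := expMoment_recurrence n p r
    have h2 := expMoment_recurrence (n + 1) p r
    rw [add_sub_cancel_right] at h2
    rw [h0] at h1 h2 hI
    push_cast at h2
    refine (mul_eq_zero.1 ?_).resolve_right (expMoment_succ_ne_zero hp hr h0)
    linear_combination K * h2 - p * hI + 3 / 4 * p * h1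
  all_goals exact Continuous.intervalIntegrable (by fun_prop) _ _

lemma nonscattering_relation {a b k q : ℝ} (hb : 0 < b) (hab : b < a) (hk : 0 < k) (hq : 0 < q)
    {n : ℤ}
    (hvan : ∀ lam : ℝ, 0 < lam →
      (∫ p in {p : ℝ × ℝ | p.1 ^ 2 / a ^ 2 + p.2 ^ 2 / b ^ 2 < 1},
        herglotzH n k p *
          Complex.exp ((lam : ℂ) * (p.1 : ℂ)
            + Complex.I * ((Real.sqrt (lam ^ 2 + k ^ 2 * q) : ℝ) : ℂ) * (p.2 : ℂ))) = 0) :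
    besselJ n ((k * Real.sqrt (a ^ 2 + b ^ 2) : ℝ) : ℂ) = 0 ∧
      3 * (a ^ 2 + b ^ 2) ^ 2 = 2 * a ^ 2 * b ^ 2 * (n + 1) := by
  have ha : 0 < a := hb.trans hab
  have hab2 : 0 < a ^ 2 - b ^ 2 := by nlinarith
  set c := Real.sqrt (a ^ 2 - b ^ 2) with hcdef
  have hc : 0 < c := Real.sqrt_pos.2 hab2
  have hc2 : c ^ 2 = a ^ 2 - b ^ 2 := Real.sq_sqrt hab2.le
  have hcC0 : (c : ℂ) ≠ 0 := by exact_mod_cast hc.ne'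
  have hcC : (c : ℂ) ^ 2 = (a : ℂ) ^ 2 - (b : ℂ) ^ 2 := by exact_mod_cast hc2
  have hkC0 : (k : ℂ) ≠ 0 := by exact_mod_cast hk.ne'
  set p : ℂ := Complex.I * k * ((a : ℂ) ^ 2 + (b : ℂ) ^ 2) / (2 * c) with hp
  set r : ℂ := Complex.I * k * ((a : ℂ) ^ 2 - (b : ℂ) ^ 2) / (2 * c) with hr
  have hp0 : p ≠ 0 := by
    have : (a : ℂ) ^ 2 + (b : ℂ) ^ 2 ≠ 0 := by
      exact_mod_cast (by positivity : a ^ 2 + b ^ 2 ≠ 0)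
    simp [hp, hkC0, hcC0, this]
  have hr0 : r ≠ 0 := by
    have : (a : ℂ) ^ 2 - (b : ℂ) ^ 2 ≠ 0 := by exact_mod_cast hab2.ne'
    simp [hr, hkC0, hcC0, this]
  have hu : ∀ α : ℝ, p * circlePt α + r * (circlePt α)⁻¹ =
      Complex.I * k * ((a : ℂ) ^ 2 * Real.cos α + Complex.I * (b : ℂ) ^ 2 * Real.sin α) / c := by
    intro α
    rw [circlePt_inv_eq, circlePt_eq, hp, hr]
    field_simp
    ring
  set gap : ℝ → ℝ := fun x =>
    Real.sqrt ((2 * x / c) ^ 2 + (k * Real.sqrt q) ^ 2) - 2 * x / c with hgap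
  have hgap0 : Tendsto gap atTop (𝓝 0) := by
    refine (tendsto_sqrt_sq_add_sub (k * Real.sqrt q)).comp ?_
    exact (tendsto_id.const_mul_atTop (by norm_num : (0 : ℝ) < 2)).atTop_div_const hc
  set w : ℝ → ℝ → ℂ := fun x α => ((-(b ^ 2 * k ^ 2 * q + k ^ 2 * (a ^ 2 * Real.cos α ^ 2 +
    b ^ 2 * Real.sin α ^ 2) + 2 * b ^ 2 * k * gap x * Real.sin α) / 4 : ℝ) : ℂ) with hw
  set w₀ : ℝ → ℂ := fun α => ((-(b ^ 2 * k ^ 2 * q + k ^ 2 * (a ^ 2 * Real.cos α ^ 2 +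
    b ^ 2 * Real.sin α ^ 2) + 2 * b ^ 2 * k * 0 * Real.sin α) / 4 : ℝ) : ℂ) with hw₀
  have hmain := second_order_of_integral_eventually_zero (n := n) (p := p) (r := r) (w := w)
    (w₀ := w₀) (B := (b ^ 2 * k ^ 2 * q + k ^ 2 * (a ^ 2 + b ^ 2) + 2 * b ^ 2 * k) / 4)
    (fun x => by fun_prop) ?_ ?_ ?_
  · obtain ⟨h0, hI⟩ := hmain
    constructor
    · refine besselJ_eq_zero_of_expMoment_eq_zero hp0 hr0 ?_ h0
      have hs : ((Real.sqrt (a ^ 2 + b ^ 2) : ℝ) : ℂ) ^ 2 = (a : ℂ) ^ 2 + (b : ℂ) ^ 2 := by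
        exact_mod_cast Real.sq_sqrt (by positivity : 0 ≤ a ^ 2 + b ^ 2)
      push_cast
      rw [div_pow, mul_pow, hs, hp, hr, ← hcC]
      field_simp
      linear_combination ((a : ℂ) ^ 2 + (b : ℂ) ^ 2) * Complex.I_sq
    · have hrel := expMoment_relation (C := -((b : ℂ) ^ 2 * k ^ 2 * q) / 4)
        (K := (k : ℂ) ^ 2 * a ^ 2 * b ^ 2 / (4 * c ^ 2)) hp0 hr0 h0 ?_
      · rw [hp] at hrel
        field_simp at hrel
        rw [Complex.I_sq] at hrel
        have hrel' : 3 * ((a : ℂ) ^ 2 + (b : ℂ) ^ 2) ^ 2 =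
            2 * (a : ℂ) ^ 2 * (b : ℂ) ^ 2 * (n + 1) := by
          refine mul_left_cancel₀ (pow_ne_zero 2 hkC0) ?_
          linear_combination -hrel / 4
        exact_mod_cast hrel'
      · rw [← hI]
        congr 1; funext α
        congr 2
        rw [hu, circlePt_eq]
        simp only [hw₀]
        push_cast
        field_simp
        rw [hcC]
        linear_combination ((k : ℂ) * ((a : ℂ) ^ 2 * b ^ 2 * (Complex.sin α ^ 2 +
          2 * Complex.I * Complex.cos α * Complex.sin α) +
          (b : ℂ) ^ 4 * (Complex.I ^ 2 - 1) * Complex.sin α ^ 2 +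
          (a : ℂ) ^ 4 * Complex.cos α ^ 2)) * Complex.I_sq
  · filter_upwards [hgap0.norm.eventually_le_const (by norm_num : ‖(0 : ℝ)‖ < 1)] with x hx α
    rw [Real.norm_eq_abs] at hx
    simp only [hw]
    rw [Complex.norm_real, Real.norm_eq_abs, abs_div, abs_neg, abs_of_pos (by norm_num : (0:ℝ) < 4)]
    gcongr
    refine (abs_add_le _ _).trans (add_le_add ?_ ?_)
    · rw [abs_of_nonneg (by positivity)]
      have h1 := Real.cos_sq_le_one α
      have h2 := Real.sin_sq_le_one α
      have h3 : a ^ 2 * Real.cos α ^ 2 ≤ a ^ 2 * 1 := by gcongr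
      have h4 : b ^ 2 * Real.sin α ^ 2 ≤ b ^ 2 * 1 := by gcongr
      gcongr
      · linarith
      · linarith
    · rw [mul_assoc (2 * b ^ 2 * k), abs_mul (2 * b ^ 2 * k), abs_mul (gap x),
        abs_of_pos (by positivity : 0 < 2 * b ^ 2 * k)]
      have h1 := mul_le_one₀ hx (abs_nonneg _) (Real.abs_sin_le_one α)
      calc 2 * b ^ 2 * k * (|gap x| * |Real.sin α|) ≤ 2 * b ^ 2 * k * 1 := by gcongr
        _ = 2 * b ^ 2 * k := mul_one _
  · intro α
    refine (Complex.continuous_ofReal.tendsto _).comp ?_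
    exact ((((hgap0.const_mul _).mul_const _).const_add _).neg).div_const _
  · filter_upwards [eventually_gt_atTop 0] with x hx
    have hlam : 0 < 2 * x / c := by positivity
    have h := hvan (2 * x / c) hlam
    rw [integral_ellipse_herglotzH ha hb] at h
    have hpre : (a : ℂ) * b * Real.pi ≠ 0 := by
      exact_mod_cast (by positivity : a * b * Real.pi ≠ 0)
    rw [← (mul_eq_zero.1 h).resolve_left hpre]
    congr 1; funext α
    congr 2
    have hkq : (k * Real.sqrt q) ^ 2 = k ^ 2 * q := by rw [mul_pow, Real.sq_sqrt hq.le]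
    set μ := Real.sqrt ((2 * x / c) ^ 2 + k ^ 2 * q) with hμ
    have hμ2 : (μ : ℂ) ^ 2 = (2 * x / c : ℂ) ^ 2 + (k : ℂ) ^ 2 * q := by
      exact_mod_cast Real.sq_sqrt (by positivity : 0 ≤ (2 * x / c) ^ 2 + k ^ 2 * q)
    have hgapx : gap x = μ - 2 * x / c := by simp only [hgap, hkq, hμ]
    have hxC0 : (x : ℂ) ≠ 0 := by exact_mod_cast hx.ne'
    rw [mul_add, mul_div_cancel₀ _ hxC0, hu]
    simp only [hw, hgapx]
    push_cast
    obtain ⟨l, hl⟩ : ∃ l : ℂ, (x : ℂ) = l * c / 2 := ⟨2 * x / c, by field_simp⟩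
    have hlc : 2 * (l * c / 2) / (c : ℂ) = l := by field_simp
    have hIc : ∀ y : ℂ, l * c / 2 * (Complex.I * k * y / c) = l * Complex.I * k * y / 2 :=
      fun y => by field_simp
    rw [hl, hlc] at hμ2
    rw [hl, hlc, hIc]
    linear_combination (l ^ 2 / 4) * hcC + ((b : ℂ) ^ 2 / 4) * hμ2 +
      ((b : ℂ) ^ 2 * k * l * Complex.sin α / 2 - (a : ℂ) ^ 2 * k ^ 2 * Complex.cos α ^ 2 / 4 -
        (b : ℂ) ^ 2 * (μ ^ 2 + 2 * μ * k * Complex.sin α + k ^ 2 * Complex.sin α ^ 2) / 4) *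
        Complex.I_sq

theorem stmt5
    (a b k q : ℝ) (hb : 0 < b) (hab : b < a) (hk : 0 < k) (hq : 0 < q) (hq1 : q ≠ 1)
    (n : ℤ)
    (hcase : besselJ n ((k * Real.sqrt (a ^ 2 + b ^ 2) : ℝ) : ℂ) ≠ 0 ∨ n ≤ 5 ∨
      (5 < n ∧ a ^ 2 / b ^ 2 ≠ ((n : ℝ) - 2 + Real.sqrt (((n : ℝ) - 5) * ((n : ℝ) + 1))) / 3)) :
    ¬ (∀ lam : ℝ, 0 < lam →
      (∫ p in {p : ℝ × ℝ | p.1 ^ 2 / a ^ 2 + p.2 ^ 2 / b ^ 2 < 1},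
        herglotzH n k p *
          Complex.exp ((lam : ℂ) * (p.1 : ℂ)
            + Complex.I * ((Real.sqrt (lam ^ 2 + k ^ 2 * q) : ℝ) : ℂ) * (p.2 : ℂ))) = 0) := by
  intro hvan
  obtain ⟨hJ, hrel⟩ := nonscattering_relation hb hab hk hq hvan
  have hab2 : b ^ 2 < a ^ 2 := by gcongr
  have hb2 : 0 < b ^ 2 := by positivity
  rcases hcase with h | h | ⟨-, h⟩
  · exact h hJ
  · have hn : (n : ℝ) ≤ 5 := by exact_mod_cast h
    have h1 : 2 * a ^ 2 * b ^ 2 * (n + 1) ≤ 2 * a ^ 2 * b ^ 2 * (5 + 1) := by gcongr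
    nlinarith [sq_pos_of_pos (sub_pos.2 hab2)]
  · apply h
    set ρ := a ^ 2 / b ^ 2 with hρ
    have hρ1 : 1 < ρ := (one_lt_div hb2).2 hab2
    have hquad : 3 * ρ ^ 2 - 2 * (n - 2) * ρ + 3 = 0 := by
      rw [hρ]
      field_simp
      linear_combination hrel
    have hpos : 0 ≤ 3 * ρ - (n - 2) := by
      have : 0 ≤ (3 * ρ - (n - 2)) * ρ := by nlinarith
      exact nonneg_of_mul_nonneg_left this (by linarith)
    have hsq : ((n : ℝ) - 5) * (n + 1) = (3 * ρ - (n - 2)) ^ 2 := by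
      linear_combination -3 * hquad
    rw [hsq, Real.sqrt_sq hpos]
    ring
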